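/- Let $\omega \in A_1$ and $0 < r < 1$. Then the weighted BMO spaces $BMO(\omega)$ and $BMO^r(\omega)$ coincide with equivalent norms: there exists $C \geq 1$ such that for all locally integrable $f$, $C^{-1}\|f\|_{BMO(\omega)} \leq \|f\|_{BMO^r(\omega)} \leq C\,\|f\|_{BMO(\omega)}$, where $\|f\|_{BMO^p(\omega)} = \sup_Q \left(\frac{1}{\omega(Q)}\int_Q |f(x)-f_Q|^p\,\omega(x)^{1-p}\,dx\right)^{1/p}$ and $BMO(\omega) = BMO^1(\omega)$. -/

import Mathlib

open MeasureTheory Real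
noncomputable section

abbrev Rn (n : ℕ) := EuclideanSpace ℝ (Fin n)

def cube {n : ℕ} (c : Rn n) (r : ℝ) : Set (Rn n) := {y | ∀ i, |y i - c i| ≤ r / 2}

def wMeas {n : ℕ} (ω : Rn n → ℝ) (S : Set (Rn n)) : ℝ := ∫ x in S, ω x

def avg {n : ℕ} (f : Rn n → ℝ) (c : Rn n) (r : ℝ) : ℝ := (∫ x in cube c r, f x) / r ^ n

def IsA1 {n : ℕ} (ω : Rn n → ℝ) (A : ℝ) : Prop :=
  (∀ x, 0 < ω x) ∧ LocallyIntegrable ω volume ∧ 1 ≤ A ∧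
  ∀ (c : Rn n) (r : ℝ), 0 < r →
    ∀ᵐ x ∂(volume : Measure (Rn n)), x ∈ cube c r → wMeas ω (cube c r) / r ^ n ≤ A * ω x

def IsAp {n : ℕ} (ω : Rn n → ℝ) (p A : ℝ) : Prop :=
  (∀ x, 0 < ω x) ∧ LocallyIntegrable ω volume ∧
  ∀ (c : Rn n) (r : ℝ), 0 < r →
    (wMeas ω (cube c r) / r ^ n) *
      ((∫ x in cube c r, ω x ^ (-(1 / (p - 1)))) / r ^ n) ^ (p - 1) ≤ A

def IsAinf {n : ℕ} (ω : Rn n → ℝ) : Prop := ∃ p A, 1 < p ∧ IsAp ω p A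

/-! ### cubes -/

lemma cube_eq {n : ℕ} (c : Rn n) (ρ : ℝ) :
    cube c ρ = (WithLp.ofLp : Rn n → (Fin n → ℝ)) ⁻¹'
      (Set.Icc (fun i => c i - ρ / 2) (fun i => c i + ρ / 2)) := by
  ext y
  simp only [cube, Set.mem_ofPred_eq, Set.mem_preimage, Set.mem_Icc, Pi.le_def]
  constructor
  · intro h
    exact ⟨fun i => by have := (abs_le.mp (h i)).1; linarith,
      fun i => by have := (abs_le.mp (h i)).2; linarith⟩
  · rintro ⟨h1, h2⟩ i
    exact abs_le.mpr ⟨by linarith [h1 i], by linarith [h2 i]⟩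

lemma cube_meas {n : ℕ} (c : Rn n) (ρ : ℝ) : MeasurableSet (cube c ρ) := by
  rw [cube_eq]
  exact (PiLp.volume_preserving_ofLp (Fin n)).measurable measurableSet_Icc

lemma cube_compact {n : ℕ} (c : Rn n) (ρ : ℝ) : IsCompact (cube c ρ) := by
  rw [cube_eq]
  exact ((PiLp.homeomorph 2 (fun _ : Fin n => ℝ)).isCompact_preimage).mpr isCompact_Icc

lemma cube_vol {n : ℕ} (c : Rn n) {ρ : ℝ} (hρ : 0 < ρ) :
    volume.real (cube c ρ) = ρ ^ n := by
  rw [cube_eq, measureReal_def,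
    (PiLp.volume_preserving_ofLp (Fin n)).measure_preimage measurableSet_Icc.nullMeasurableSet,
    Real.volume_Icc_pi_toReal]
  · simp
  · intro i; simp only; linarith

def child {n : ℕ} (c : Rn n) (ρ : ℝ) (s : Fin n → Bool) : Rn n :=
  WithLp.toLp 2 (fun i => c i + (if s i then ρ / 4 else -(ρ / 4)))

lemma child_union {n : ℕ} (c : Rn n) {ρ : ℝ} (hρ : 0 < ρ) :
    cube c ρ = ⋃ s : Fin n → Bool, cube (child c ρ s) (ρ / 2) := by
  ext y
  simp only [cube, child, Set.mem_ofPred_eq, Set.mem_iUnion]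
  constructor
  · intro h
    refine ⟨fun i => decide (c i ≤ y i), fun i => ?_⟩
    have := abs_le.mp (h i)
    by_cases hc : c i ≤ y i
    · simp only [hc, decide_true, if_true]
      exact abs_le.mpr ⟨by linarith, by linarith⟩
    · simp only [hc, decide_false]
      push Not at hc
      exact abs_le.mpr ⟨by simp; linarith, by simp; linarith⟩
  · rintro ⟨s, h⟩ i
    have := abs_le.mp (h i)
    by_cases hs : s i = true
    · simp only [hs, if_true] at this
      exact abs_le.mpr ⟨by linarith, by linarith⟩
    · simp only [hs] at this
      simp at this
      exact abs_le.mpr ⟨by linarith, by linarith⟩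

lemma child_sub {n : ℕ} (c : Rn n) {ρ : ℝ} (hρ : 0 < ρ) (s : Fin n → Bool) :
    cube (child c ρ s) (ρ / 2) ⊆ cube c ρ := by
  rw [child_union c hρ]
  exact Set.subset_iUnion (fun s : Fin n → Bool => cube (child c ρ s) (ρ / 2)) s

lemma hyper_null {n : ℕ} (i : Fin n) (a : ℝ) : volume {y : Rn n | y i = a} = 0 := by
  have h : {y : Rn n | y i = a} = (WithLp.ofLp : Rn n → (Fin n → ℝ)) ⁻¹' {y | y i = a} := rfl
  have hm : MeasurableSet {y : Fin n → ℝ | y i = a} :=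
    measurableSet_eq_fun (measurable_pi_apply i) measurable_const
  rw [h, (PiLp.volume_preserving_ofLp (Fin n)).measure_preimage hm.nullMeasurableSet]
  exact Measure.pi_hyperplane (fun _ : Fin n => (volume : Measure ℝ)) i a

lemma child_disj {n : ℕ} (c : Rn n) {ρ : ℝ} :
    Pairwise (fun s t : Fin n → Bool =>
      AEDisjoint volume (cube (child c ρ s) (ρ / 2)) (cube (child c ρ t) (ρ / 2))) := by
  intro s t hst
  obtain ⟨i, hi⟩ := Function.ne_iff.mp hst
  refine measure_mono_null ?_ (hyper_null i (c i))
  rintro y ⟨h1, h2⟩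
  have h1 := abs_le.mp (h1 i)
  have h2 := abs_le.mp (h2 i)
  simp only [child] at h1 h2
  simp only [Set.mem_ofPred_eq]
  cases hs : s i <;> cases ht : t i <;> simp_all <;> linarith

lemma integral_children {n : ℕ} (c : Rn n) {ρ : ℝ} (hρ : 0 < ρ) (g : Rn n → ℝ)
    (hg : IntegrableOn g (cube c ρ)) :
    ∫ x in cube c ρ, g x = ∑ s : Fin n → Bool, ∫ x in cube (child c ρ s) (ρ / 2), g x := by
  rw [child_union c hρ] at hg ⊢
  rw [integral_iUnion_ae (fun s => (cube_meas _ _).nullMeasurableSet) (child_disj c) hg,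
    tsum_fintype]

lemma vol_split {n : ℕ} (ρ : ℝ) : ρ ^ n = ∑ _s : Fin n → Bool, (ρ / 2) ^ n := by
  simp [div_pow]
  field_simp

lemma loc_cube {n : ℕ} {f : Rn n → ℝ} (hf : LocallyIntegrable f volume) (c : Rn n) (ρ : ℝ) :
    IntegrableOn f (cube c ρ) := hf.integrableOn_isCompact (cube_compact c ρ)

lemma const_cube {n : ℕ} (a : ℝ) (c : Rn n) (ρ : ℝ) :
    IntegrableOn (fun _ => a) (cube c ρ) := by
  exact integrableOn_const (cube_compact c ρ).measure_lt_top.ne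

lemma int_const {n : ℕ} (a : ℝ) (c : Rn n) {ρ : ℝ} (hρ : 0 < ρ) :
    ∫ _x in cube c ρ, a = a * ρ ^ n := by
  rw [setIntegral_const, cube_vol c hρ, smul_eq_mul, mul_comm]

lemma int_abs {n : ℕ} {f : Rn n → ℝ} (hf : LocallyIntegrable f volume) (a : ℝ) (c : Rn n)
    (ρ : ℝ) : IntegrableOn (fun x => |f x - a|) (cube c ρ) :=
  ((loc_cube hf c ρ).sub (const_cube a c ρ)).abs

lemma rpow_le_young {g w r : ℝ} (hg : 0 ≤ g) (hw : 0 ≤ w) (hr0 : 0 < r) (hr1 : r < 1) :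
    g ^ r * w ^ (1 - r) ≤ r * g + (1 - r) * w :=
  Real.geom_mean_le_arith_mean2_weighted hr0.le (by linarith) hg hw (by ring)

lemma int_mix {n : ℕ} {f ω : Rn n → ℝ} (hf : LocallyIntegrable f volume)
    (hω : LocallyIntegrable ω volume) (hpos : ∀ x, 0 < ω x) {r : ℝ} (hr0 : 0 < r) (hr1 : r < 1)
    (a : ℝ) (c : Rn n) (ρ : ℝ) :
    IntegrableOn (fun x => |f x - a| ^ r * ω x ^ (1 - r)) (cube c ρ) := by
  refine Integrable.mono' (((int_abs hf a c ρ).const_mul r).add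
    ((loc_cube hω c ρ).const_mul (1 - r))) ?_ ?_
  · exact (((int_abs hf a c ρ).aestronglyMeasurable.aemeasurable.pow_const r).mul
      ((loc_cube hω c ρ).aestronglyMeasurable.aemeasurable.pow_const (1 - r))).aestronglyMeasurable
  · refine Filter.Eventually.of_forall fun x => ?_
    have h0 : 0 ≤ |f x - a| ^ r * ω x ^ (1 - r) :=
      mul_nonneg (Real.rpow_nonneg (abs_nonneg _) _) (Real.rpow_nonneg (hpos x).le _)
    rw [Real.norm_eq_abs, abs_of_nonneg h0]
    exact rpow_le_young (abs_nonneg _) (hpos x).le hr0 hr1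

lemma int_pow {n : ℕ} {f : Rn n → ℝ} (hf : LocallyIntegrable f volume)
    {r : ℝ} (hr0 : 0 < r) (hr1 : r < 1) (a : ℝ) (c : Rn n) (ρ : ℝ) :
    IntegrableOn (fun x => |f x - a| ^ r) (cube c ρ) := by
  have h := int_mix hf (locallyIntegrable_const (1 : ℝ)) (fun _ => one_pos) hr0 hr1 a c ρ
  simpa using h

lemma wMeas_pos {n : ℕ} {ω : Rn n → ℝ} (hω : LocallyIntegrable ω volume) (hpos : ∀ x, 0 < ω x)
    (c : Rn n) {ρ : ℝ} (hρ : 0 < ρ) : 0 < wMeas ω (cube c ρ) := by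
  unfold wMeas
  rw [setIntegral_pos_iff_support_of_nonneg_ae
    (Filter.Eventually.of_forall fun x => (hpos x).le) (loc_cube hω c ρ)]
  have hs : Function.support ω = Set.univ := by
    ext x; simp [(hpos x).ne']
  rw [hs, Set.univ_inter]
  have := cube_vol c hρ
  by_contra h0
  have h1 : volume (cube c ρ) = 0 := by simpa using h0
  rw [measureReal_def, h1] at this
  have := pow_pos hρ n
  simp_all

/-! ### second direction -/

lemma dir2 {n : ℕ} {f ω : Rn n → ℝ} (hf : LocallyIntegrable f volume)
    (hω : LocallyIntegrable ω volume) (hpos : ∀ x, 0 < ω x) {r : ℝ} (hr0 : 0 < r) (hr1 : r < 1)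
    (a : ℝ) (c : Rn n) {ρ : ℝ} (hρ : 0 < ρ) {N : ℝ} (hN : 0 < N)
    (h : (wMeas ω (cube c ρ))⁻¹ * ∫ x in cube c ρ, |f x - a| ≤ N) :
    ((wMeas ω (cube c ρ))⁻¹ * ∫ x in cube c ρ, |f x - a| ^ r * ω x ^ (1 - r)) ^ (1 / r) ≤ N := by
  have hW := wMeas_pos hω hpos c hρ
  rw [inv_mul_le_iff₀ hW] at h
  have h1 : ∫ x in cube c ρ, |f x - a| ^ r * ω x ^ (1 - r) ≤
      ∫ x in cube c ρ, N ^ r * (r / N * |f x - a| + (1 - r) * ω x) := by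
    refine integral_mono (int_mix hf hω hpos hr0 hr1 a c ρ)
      ((((int_abs hf a c ρ).const_mul (r / N)).add
        ((loc_cube hω c ρ).const_mul (1 - r))).const_mul (N ^ r)) fun x => ?_
    have := rpow_le_young (div_nonneg (abs_nonneg (f x - a)) hN.le) (hpos x).le hr0 hr1
    rw [Real.div_rpow (abs_nonneg _) hN.le] at this
    have hNr := Real.rpow_pos_of_pos hN r
    calc |f x - a| ^ r * ω x ^ (1 - r) = N ^ r * (|f x - a| ^ r / N ^ r * ω x ^ (1 - r)) := by
          field_simp
      _ ≤ N ^ r * (r * (|f x - a| / N) + (1 - r) * ω x) := by gcongr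
      _ = _ := by ring
  rw [integral_const_mul, integral_add ((int_abs hf a c ρ).const_mul (r / N))
        ((loc_cube hω c ρ).const_mul (1 - r)), integral_const_mul, integral_const_mul] at h1
  change _ ≤ N ^ r * (_ + (1 - r) * wMeas ω (cube c ρ)) at h1
  have hNr := Real.rpow_pos_of_pos hN r
  have h2 : r / N * (∫ x in cube c ρ, |f x - a|) ≤ r * wMeas ω (cube c ρ) := by
    calc _ ≤ r / N * (wMeas ω (cube c ρ) * N) := by gcongr
      _ = _ := by field_simp
  have h3 : ∫ x in cube c ρ, |f x - a| ^ r * ω x ^ (1 - r) ≤ wMeas ω (cube c ρ) * N ^ r := by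
    refine h1.trans ?_
    calc _ ≤ N ^ r * (r * wMeas ω (cube c ρ) + (1 - r) * wMeas ω (cube c ρ)) := by gcongr
      _ = _ := by ring
  rw [← inv_mul_le_iff₀ hW] at h3
  have h0 : 0 ≤ (wMeas ω (cube c ρ))⁻¹ * ∫ x in cube c ρ, |f x - a| ^ r * ω x ^ (1 - r) :=
    mul_nonneg (inv_nonneg.mpr hW.le) (integral_nonneg fun x =>
      mul_nonneg (Real.rpow_nonneg (abs_nonneg _) _) (Real.rpow_nonneg (hpos x).le _))
  calc _ ≤ (N ^ r) ^ (1 / r) := Real.rpow_le_rpow h0 h3 (by positivity)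
    _ = N := by rw [← Real.rpow_mul hN.le, mul_one_div_cancel hr0.ne', Real.rpow_one]

/-! ### dyadic sums -/

def dD {n : ℕ} (f : Rn n → ℝ) : ℕ → Rn n → ℝ → ℝ → ℝ
  | 0, c, ρ, a => ρ ^ n * |avg f c ρ - a|
  | k + 1, c, ρ, a => ∑ s : Fin n → Bool, dD f k (child c ρ s) (ρ / 2) a

def dH {n : ℕ} (f : Rn n → ℝ) : ℕ → Rn n → ℝ → ℝ
  | 0, c, ρ => ∫ x in cube c ρ, |f x - avg f c ρ|
  | k + 1, c, ρ => ∑ s : Fin n → Bool, dH f k (child c ρ s) (ρ / 2)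

lemma int_avg {n : ℕ} {f : Rn n → ℝ} (hf : LocallyIntegrable f volume) (a : ℝ) (c : Rn n)
    {ρ : ℝ} (hρ : 0 < ρ) : ρ ^ n * |avg f c ρ - a| ≤ ∫ x in cube c ρ, |f x - a| := by
  have hp := pow_pos hρ n
  have h1 : ρ ^ n * (avg f c ρ - a) = ∫ x in cube c ρ, (f x - a) := by
    rw [integral_sub (loc_cube hf c ρ) (const_cube a c ρ), int_const a c hρ, avg]
    field_simp
  rw [← abs_of_pos hp, ← abs_mul, h1]
  exact abs_integral_le_integral_abs

lemma int_le_dD {n : ℕ} {f : Rn n → ℝ} (hf : LocallyIntegrable f volume) (a : ℝ) (k : ℕ) :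
    ∀ (c : Rn n) (ρ : ℝ), 0 < ρ →
      ∫ x in cube c ρ, |f x - a| ≤ dH f k c ρ + dD f k c ρ a := by
  induction k with
  | zero =>
    intro c ρ hρ
    simp only [dH, dD]
    calc ∫ x in cube c ρ, |f x - a| ≤
          ∫ x in cube c ρ, (|f x - avg f c ρ| + |avg f c ρ - a|) :=
          integral_mono (int_abs hf a c ρ) ((int_abs hf _ c ρ).add (const_cube _ c ρ))
            fun x => abs_sub_le _ _ _
      _ = _ := by
          rw [integral_add (int_abs hf _ c ρ) (const_cube _ c ρ), int_const _ c hρ]; ring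
  | succ k ih =>
    intro c ρ hρ
    simp only [dH, dD]
    rw [integral_children c hρ _ (int_abs hf a c ρ), ← Finset.sum_add_distrib]
    exact Finset.sum_le_sum fun s _ => ih _ _ (by positivity)

lemma dH_le {n : ℕ} {f g : Rn n → ℝ} (hf : LocallyIntegrable f volume)
    (hg : LocallyIntegrable g volume) {ε δ : ℝ}
    (hosc : ∀ (c : Rn n) (ρ : ℝ), 0 < ρ → ρ ≤ δ → ∀ x ∈ cube c ρ, |g x - g c| ≤ ε) (k : ℕ) :
    ∀ (c : Rn n) (ρ : ℝ), 0 < ρ → ρ ≤ δ * 2 ^ k →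
      dH f k c ρ ≤ 2 * (∫ x in cube c ρ, |f x - g x|) + 2 * ε * ρ ^ n := by
  have hfg : ∀ (c : Rn n) (ρ : ℝ), IntegrableOn (fun x => |f x - g x|) (cube c ρ) :=
    fun c ρ => ((loc_cube hf c ρ).sub (loc_cube hg c ρ)).abs
  induction k with
  | zero =>
    intro c ρ hρ hδ
    simp only [dH]
    have h1 : ∫ x in cube c ρ, |f x - avg f c ρ| ≤ 2 * ∫ x in cube c ρ, |f x - g c| := by
      calc ∫ x in cube c ρ, |f x - avg f c ρ| ≤
            ∫ x in cube c ρ, (|f x - g c| + |avg f c ρ - g c|) :=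
            integral_mono (int_abs hf _ c ρ) ((int_abs hf _ c ρ).add (const_cube _ c ρ))
              fun x => by
                have := abs_sub_le (f x) (g c) (avg f c ρ)
                rwa [abs_sub_comm (g c)] at this
        _ = (∫ x in cube c ρ, |f x - g c|) + ρ ^ n * |avg f c ρ - g c| := by
            rw [integral_add (int_abs hf _ c ρ) (const_cube _ c ρ), int_const _ c hρ]; ring
        _ ≤ _ := by linarith [int_avg hf (g c) c hρ]
    have h2 : ∫ x in cube c ρ, |f x - g c| ≤ (∫ x in cube c ρ, |f x - g x|) + ε * ρ ^ n := by
      rw [← int_const ε c hρ, ← integral_add (hfg c ρ) (const_cube _ c ρ)]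
      refine setIntegral_mono_on (int_abs hf _ c ρ) ((hfg c ρ).add (const_cube _ c ρ))
        (cube_meas c ρ) fun x hx => ?_
      have := hosc c ρ hρ (by simpa using hδ) x hx
      linarith [abs_sub_le (f x) (g x) (g c)]
    linarith
  | succ k ih =>
    intro c ρ hρ hδ
    simp only [dH]
    rw [integral_children c hρ _ (hfg c ρ), vol_split (n := n) ρ, Finset.mul_sum, Finset.mul_sum,
      ← Finset.sum_add_distrib]
    refine Finset.sum_le_sum fun s _ => ih _ _ (by positivity) ?_
    rw [pow_succ] at hδ; linarith

lemma cube_dist {n : ℕ} {c x : Rn n} {ρ : ℝ} (hx : x ∈ cube c ρ) (hρ : 0 < ρ) :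
    dist x c ≤ (n + 1) * ρ := by
  rw [EuclideanSpace.dist_eq]
  refine Real.sqrt_le_iff.mpr ⟨by positivity, ?_⟩
  calc ∑ i, dist (x i) (c i) ^ 2 ≤ ∑ _i : Fin n, ρ ^ 2 := by
        refine Finset.sum_le_sum fun i _ => ?_
        rw [Real.dist_eq]
        have := hx i
        exact pow_le_pow_left₀ (abs_nonneg _) (by linarith) 2
    _ = n * ρ ^ 2 := by simp
    _ ≤ ((n + 1) * ρ) ^ 2 := by
        rw [mul_pow]
        have : (n : ℝ) ≤ (n + 1) ^ 2 := by nlinarith [Nat.cast_nonneg (α := ℝ) n]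
        gcongr

lemma int_le_of_dD {n : ℕ} {f : Rn n → ℝ} (hf : LocallyIntegrable f volume) (a B : ℝ)
    (c : Rn n) {ρ : ℝ} (hρ : 0 < ρ) (hB : ∀ k, dD f k c ρ a ≤ B) :
    ∫ x in cube c ρ, |f x - a| ≤ B := by
  refine le_of_forall_pos_le_add fun η hη => ?_
  have hp := pow_pos hρ n
  set ε := η / (4 * ρ ^ n) with hε
  have hεp : 0 < ε := by positivity
  have hind : Integrable ((cube c ρ).indicator f) volume :=
    (integrable_indicator_iff (cube_meas c ρ)).mpr (loc_cube hf c ρ)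
  obtain ⟨g, hgs, hgle, hgc, hgi⟩ :=
    hind.exists_hasCompactSupport_integral_sub_le (ε := η / 4) (by positivity)
  have huc : UniformContinuous g := hgs.uniformContinuous_of_continuous hgc
  obtain ⟨δ, hδ, hd⟩ := Metric.uniformContinuous_iff.mp huc ε hεp
  have hosc : ∀ (c : Rn n) (ρ : ℝ), 0 < ρ → ρ ≤ δ / (2 * (n + 1)) →
      ∀ x ∈ cube c ρ, |g x - g c| ≤ ε := by
    intro c ρ hρ hle x hx
    have h1 := cube_dist hx hρ
    have h2 : (n + 1) * ρ ≤ δ / 2 := by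
      calc ((n : ℝ) + 1) * ρ ≤ (n + 1) * (δ / (2 * (n + 1))) := by gcongr
        _ = _ := by field_simp
    have := hd (a := x) (b := c) (by linarith)
    rw [Real.dist_eq] at this
    exact this.le
  obtain ⟨k, hk⟩ := pow_unbounded_of_one_lt (ρ / (δ / (2 * (n + 1)))) (one_lt_two (α := ℝ))
  have hk' : ρ ≤ δ / (2 * (n + 1)) * 2 ^ k := by
    rw [div_lt_iff₀ (by positivity)] at hk; linarith
  have h1 := dH_le hf hgi.locallyIntegrable hosc k c ρ hρ hk'
  have h2 := int_le_dD hf a k c ρ hρ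
  have h3 : ∫ x in cube c ρ, |f x - g x| ≤ η / 4 := by
    calc ∫ x in cube c ρ, |f x - g x| = ∫ x in cube c ρ, ‖(cube c ρ).indicator f x - g x‖ := by
          refine setIntegral_congr_fun (cube_meas c ρ) fun x hx => ?_
          simp [Set.indicator_of_mem hx]
      _ ≤ ∫ x, ‖(cube c ρ).indicator f x - g x‖ :=
          setIntegral_le_integral (hind.sub hgi).norm
            (Filter.Eventually.of_forall fun x => norm_nonneg _)
      _ ≤ _ := hgle
  have h4 : 2 * ε * ρ ^ n = η / 2 := by rw [hε]; field_simp; norm_num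
  linarith [hB k]

/-! ### stopping time -/

lemma avg_jump {n : ℕ} {f : Rn n → ℝ} (hf : LocallyIntegrable f volume) {r : ℝ} (hr0 : 0 < r)
    (hr1 : r < 1) {a : ℝ} {c : Rn n} {ρ : ℝ} (hρ : 0 < ρ) {u t : ℝ} (hu : 0 ≤ u) (ht : 0 ≤ t)
    (h1 : ∫ x in cube c ρ, |f x - avg f c ρ| ^ r ≤ u ^ r * ρ ^ n)
    (h2 : ∫ x in cube c ρ, |f x - a| ^ r ≤ t * ρ ^ n) :
    |avg f c ρ - a| ≤ 2 ^ (1 / r) * (u + t ^ (1 / r)) := by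
  have hp := pow_pos hρ n
  have h3 : |avg f c ρ - a| ^ r * ρ ^ n ≤ (u ^ r + t) * ρ ^ n := by
    rw [← int_const _ c hρ]
    calc _ ≤ ∫ x in cube c ρ, (|f x - avg f c ρ| ^ r + |f x - a| ^ r) := by
          refine integral_mono (const_cube _ c ρ)
            ((int_pow hf hr0 hr1 _ c ρ).add (int_pow hf hr0 hr1 _ c ρ)) fun x => ?_
          refine le_trans (Real.rpow_le_rpow (abs_nonneg _) ?_ hr0.le)
            (Real.rpow_add_le_add_rpow (abs_nonneg (f x - avg f c ρ)) (abs_nonneg (f x - a))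
              hr0.le hr1.le)
          have := abs_sub_le (avg f c ρ) (f x) a
          rwa [abs_sub_comm (avg f c ρ) (f x)] at this
      _ ≤ _ := by
          rw [integral_add (int_pow hf hr0 hr1 _ c ρ) (int_pow hf hr0 hr1 _ c ρ)]; linarith
  have h4 := le_of_mul_le_mul_right h3 hp
  set v := t ^ (1 / r) with hv
  have hv0 : 0 ≤ v := Real.rpow_nonneg ht _
  have htv : t = v ^ r := by
    rw [hv, ← Real.rpow_mul ht, one_div_mul_cancel hr0.ne', Real.rpow_one]
  have h5 : |avg f c ρ - a| ^ r ≤ 2 * (u + v) ^ r := by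
    rw [htv] at h4
    have e1 : u ^ r ≤ (u + v) ^ r := Real.rpow_le_rpow hu (by linarith) hr0.le
    have e2 : v ^ r ≤ (u + v) ^ r := Real.rpow_le_rpow hv0 (by linarith) hr0.le
    linarith
  have h6 := Real.rpow_le_rpow (Real.rpow_nonneg (abs_nonneg _) _) h5
    (by positivity : 0 ≤ 1 / r)
  rw [Real.mul_rpow (by norm_num) (by positivity), ← Real.rpow_mul (abs_nonneg _),
    ← Real.rpow_mul (by positivity), mul_one_div_cancel hr0.ne', Real.rpow_one,
    Real.rpow_one] at h6
  exact h6

lemma stopping_bound {n : ℕ} {f ω : Rn n → ℝ} (hf : LocallyIntegrable f volume)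
    (hω : LocallyIntegrable ω volume) (hpos : ∀ x, 0 < ω x) {r : ℝ} (hr0 : 0 < r) (hr1 : r < 1)
    {K L b t a : ℝ} (hK : 0 < K) (hL : 0 ≤ L) (hb : 0 ≤ b) (ht : 0 < t)
    (hosc : ∀ (c : Rn n) (ρ : ℝ), 0 < ρ →
      ∫ x in cube c ρ, |f x - avg f c ρ| ^ r ≤ (K * (wMeas ω (cube c ρ) / ρ ^ n)) ^ r * ρ ^ n)
    {S : Set (Rn n)}
    (hS : ∀ (c : Rn n) (ρ : ℝ), 0 < ρ → cube c ρ ⊆ S → b * ρ ^ n ≤ wMeas ω (cube c ρ))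
    (k : ℕ)
    (ih : ∀ j < k, ∀ (c : Rn n) (ρ : ℝ), 0 < ρ →
      dD f j c ρ (avg f c ρ) ≤ L * wMeas ω (cube c ρ)) :
    ∀ j ≤ k, ∀ (c : Rn n) (ρ : ℝ), 0 < ρ → cube c ρ ⊆ S →
      ∫ x in cube c ρ, |f x - a| ^ r ≤ t * ρ ^ n →
      dD f j c ρ a ≤ 2 ^ (1 / r) * (K * wMeas ω (cube c ρ) + (2 ^ n * t) ^ (1 / r) * ρ ^ n) +
        L * (wMeas ω (cube c ρ) - b * ρ ^ n + b / t * ∫ x in cube c ρ, |f x - a| ^ r) := by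
  have hj : ∀ (c : Rn n) (ρ : ℝ), 0 < ρ → ∫ x in cube c ρ, |f x - a| ^ r ≤ (2 ^ n * t) * ρ ^ n →
      ρ ^ n * |avg f c ρ - a| ≤
        2 ^ (1 / r) * (K * wMeas ω (cube c ρ) + (2 ^ n * t) ^ (1 / r) * ρ ^ n) := by
    intro c ρ hρ h
    have hp := pow_pos hρ n
    have hW := wMeas_pos hω hpos c hρ
    have := avg_jump hf hr0 hr1 hρ (by positivity) (by positivity) (hosc c ρ hρ) h
    calc _ ≤ ρ ^ n * (2 ^ (1 / r) * (K * (wMeas ω (cube c ρ) / ρ ^ n) +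
            (2 ^ n * t) ^ (1 / r))) := by gcongr
      _ = _ := by field_simp
  have hnn : ∀ (c : Rn n) (ρ : ℝ), 0 ≤ ∫ x in cube c ρ, |f x - a| ^ r := fun c ρ =>
    integral_nonneg fun x => Real.rpow_nonneg (abs_nonneg _) _
  have h2n : (1 : ℝ) ≤ 2 ^ n := one_le_pow₀ (by norm_num)
  have htri : ∀ (j : ℕ) (c : Rn n) (ρ a' : ℝ), 0 < ρ →
      dD f j c ρ a ≤ dD f j c ρ a' + ρ ^ n * |a' - a| := by
    intro j
    induction j with
    | zero =>
      intro c ρ a' hρ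
      simp only [dD]
      have hp := pow_pos hρ n
      nlinarith [abs_sub_le (avg f c ρ) a' a]
    | succ j ihj =>
      intro c ρ a' hρ
      simp only [dD]
      rw [vol_split (n := n) ρ, Finset.sum_mul, ← Finset.sum_add_distrib]
      exact Finset.sum_le_sum fun s _ => ihj _ _ _ (by positivity)
  intro j
  induction j with
  | zero =>
    intro _ c ρ hρ hcS h
    have hp := pow_pos hρ n
    simp only [dD]
    have h1 := hj c ρ hρ (h.trans (by nlinarith [mul_pos ht hp]))
    have h2 := hS c ρ hρ hcS
    have h3 : 0 ≤ b / t * ∫ x in cube c ρ, |f x - a| ^ r := mul_nonneg (by positivity) (hnn c ρ)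
    have h4 := mul_nonneg hL (by linarith : 0 ≤ wMeas ω (cube c ρ) - b * ρ ^ n +
      b / t * ∫ x in cube c ρ, |f x - a| ^ r)
    linarith
  | succ j ihj =>
    intro hjk c ρ hρ hcS h
    have hp := pow_pos hρ n
    simp only [dD]
    have hw : wMeas ω (cube c ρ) = ∑ s, wMeas ω (cube (child c ρ s) (ρ / 2)) :=
      integral_children c hρ ω (loc_cube hω c ρ)
    have hi := integral_children c hρ _ (int_pow hf hr0 hr1 a c ρ)
    have hvs := vol_split (n := n) ρ
    have key : ∀ s : Fin n → Bool, dD f j (child c ρ s) (ρ / 2) a ≤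
        2 ^ (1 / r) * (K * wMeas ω (cube (child c ρ s) (ρ / 2)) +
          (2 ^ n * t) ^ (1 / r) * (ρ / 2) ^ n) +
        L * (wMeas ω (cube (child c ρ s) (ρ / 2)) - b * (ρ / 2) ^ n +
          b / t * ∫ x in cube (child c ρ s) (ρ / 2), |f x - a| ^ r) := by
      intro s
      have hρ2 : 0 < ρ / 2 := by positivity
      by_cases hc : ∫ x in cube (child c ρ s) (ρ / 2), |f x - a| ^ r ≤ t * (ρ / 2) ^ n
      · exact ihj (by omega) _ _ hρ2 ((child_sub c hρ s).trans hcS) hc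
      · push Not at hc
        have h1 : ∫ x in cube (child c ρ s) (ρ / 2), |f x - a| ^ r ≤ 2 ^ n * t * (ρ / 2) ^ n := by
          calc _ ≤ ∫ x in cube c ρ, |f x - a| ^ r := by
                rw [hi]
                exact Finset.single_le_sum
                  (f := fun s => ∫ x in cube (child c ρ s) (ρ / 2), |f x - a| ^ r)
                  (fun s _ => hnn _ _) (Finset.mem_univ s)
            _ ≤ t * ρ ^ n := h
            _ = _ := by rw [div_pow]; field_simp
        have h2 := hj _ _ hρ2 h1
        have h3 := htri j (child c ρ s) (ρ / 2) (avg f (child c ρ s) (ρ / 2)) hρ2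
        have h4 := ih j (by omega) (child c ρ s) (ρ / 2) hρ2
        have h5 : b * (ρ / 2) ^ n ≤ b / t * ∫ x in cube (child c ρ s) (ρ / 2), |f x - a| ^ r := by
          calc b * (ρ / 2) ^ n = b / t * (t * (ρ / 2) ^ n) := by field_simp
            _ ≤ _ := by gcongr
        have h6 := mul_le_mul_of_nonneg_left h5 hL
        linarith
    refine (Finset.sum_le_sum fun s _ => key s).trans (le_of_eq ?_)
    rw [hw, hi, hvs]
    simp only [Finset.mul_sum, mul_add, mul_sub, Finset.sum_add_distrib, Finset.sum_sub_distrib]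

lemma core {n : ℕ} {f ω : Rn n → ℝ} (hf : LocallyIntegrable f volume) {A : ℝ}
    (hA1 : IsA1 ω A) {r : ℝ} (hr0 : 0 < r) (hr1 : r < 1)
    {K : ℝ} (hK : 0 < K)
    (hosc : ∀ (c : Rn n) (ρ : ℝ), 0 < ρ →
      ∫ x in cube c ρ, |f x - avg f c ρ| ^ r ≤ (K * (wMeas ω (cube c ρ) / ρ ^ n)) ^ r * ρ ^ n)
    (k : ℕ) : ∀ (c : Rn n) (ρ : ℝ), 0 < ρ → dD f k c ρ (avg f c ρ) ≤
      (2 * A * (2 ^ (1 / r) * (1 + (2 ^ n * 2) ^ (1 / r))) * K) * wMeas ω (cube c ρ) := by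
  obtain ⟨hpos, hω, hA, hA1⟩ := hA1
  have hA0 : 0 < A := by linarith
  induction k using Nat.strong_induction_on with
  | _ k ih =>
    intro c ρ hρ
    have hp := pow_pos hρ n
    have hW := wMeas_pos hω hpos c hρ
    set W := wMeas ω (cube c ρ) with hWdef
    set b := W / ρ ^ n / A with hb
    have hbp : 0 < b := by positivity
    set q := K * (W / ρ ^ n) with hq
    have hqp : 0 < q := by positivity
    have hqr := Real.rpow_pos_of_pos hqp r
    set t := 2 * q ^ r with ht
    have htp : 0 < t := by positivity
    have hS : ∀ (c' : Rn n) (ρ' : ℝ), 0 < ρ' → cube c' ρ' ⊆ cube c ρ →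
        b * ρ' ^ n ≤ wMeas ω (cube c' ρ') := by
      intro c' ρ' hρ' hsub
      rw [← int_const b c' hρ', wMeas]
      refine integral_mono_ae (const_cube _ _ _) (loc_cube hω _ _) ?_
      refine (ae_restrict_iff' (cube_meas c' ρ')).mpr ?_
      filter_upwards [hA1 c ρ hρ] with x hx hx'
      have := hx (hsub hx')
      rw [hb, div_le_iff₀ hA0]; linarith
    have h0 := hosc c ρ hρ
    rw [← hWdef, ← hq] at h0
    have main := stopping_bound hf hω hpos hr0 hr1 hK
      (L := 2 * A * (2 ^ (1 / r) * (1 + (2 ^ n * 2) ^ (1 / r))) * K) (by positivity) hbp.le htp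
      hosc hS k ih (a := avg f c ρ) k le_rfl c ρ hρ subset_rfl
      (by rw [ht]; nlinarith [mul_pos hqr hp])
    refine main.trans ?_
    have e1 : (2 ^ n * t) ^ (1 / r) * ρ ^ n = (2 ^ n * 2) ^ (1 / r) * (K * W) := by
      rw [ht, ← mul_assoc, Real.mul_rpow (by positivity) hqr.le, ← Real.rpow_mul hqp.le,
        mul_one_div_cancel hr0.ne', Real.rpow_one, hq]
      field_simp
    have e2 : W - b * ρ ^ n + b / t * ∫ x in cube c ρ, |f x - avg f c ρ| ^ r ≤
        W - W / (2 * A) := by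
      have : b / t * ∫ x in cube c ρ, |f x - avg f c ρ| ^ r ≤ b / t * (q ^ r * ρ ^ n) := by
        gcongr
      have e3 : b / t * (q ^ r * ρ ^ n) = W / (2 * A) := by
        rw [ht, hb]; field_simp
      have e4 : b * ρ ^ n = 2 * (W / (2 * A)) := by rw [hb]; field_simp
      linarith
    rw [e1, ← hWdef]
    set D : ℝ := (2 ^ n * 2) ^ (1 / r) with hD
    have hDp : 0 < D := by positivity
    set E : ℝ := 2 ^ (1 / r) with hE
    have hEp : 0 < E := by positivity
    have := mul_le_mul_of_nonneg_left e2 (by positivity : 0 ≤ 2 * A * (E * (1 + D)) * K)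
    refine (add_le_add_right this _).trans (le_of_eq ?_)
    field_simp
    ring

lemma unweight {n : ℕ} {f ω : Rn n → ℝ} (hf : LocallyIntegrable f volume) {A : ℝ}
    (hA1 : IsA1 ω A) {r : ℝ} (hr0 : 0 < r) (hr1 : r < 1) {N : ℝ} (hN : 0 < N) (a : ℝ)
    (c : Rn n) {ρ : ℝ} (hρ : 0 < ρ)
    (h : ((wMeas ω (cube c ρ))⁻¹ *
      ∫ x in cube c ρ, |f x - a| ^ r * ω x ^ (1 - r)) ^ (1 / r) ≤ N) :
    ∫ x in cube c ρ, |f x - a| ^ r ≤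
      ((A ^ ((1 - r) / r) * N) * (wMeas ω (cube c ρ) / ρ ^ n)) ^ r * ρ ^ n := by
  obtain ⟨hpos, hω, hA, hA1⟩ := hA1
  have hA0 : 0 < A := by linarith
  have hp := pow_pos hρ n
  have hW := wMeas_pos hω hpos c hρ
  set W := wMeas ω (cube c ρ) with hWdef
  set I := ∫ x in cube c ρ, |f x - a| ^ r * ω x ^ (1 - r) with hI
  have hI0 : 0 ≤ I := integral_nonneg fun x =>
      mul_nonneg (Real.rpow_nonneg (abs_nonneg _) _) (Real.rpow_nonneg (hpos x).le _)
  have h1 : I ≤ W * N ^ r := by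
    have h2 := Real.rpow_le_rpow (Real.rpow_nonneg (by positivity) _) h hr0.le
    rw [← Real.rpow_mul (by positivity), one_div_mul_cancel hr0.ne', Real.rpow_one,
      inv_mul_le_iff₀ hW] at h2
    exact h2
  set b := W / ρ ^ n with hb
  have hbp : 0 < b := by positivity
  have h3 : (b / A) ^ (1 - r) * ∫ x in cube c ρ, |f x - a| ^ r ≤ I := by
    rw [hI, ← integral_const_mul]
    refine integral_mono_ae ((int_pow hf hr0 hr1 a c ρ).const_mul _)
      (int_mix hf hω hpos hr0 hr1 a c ρ) ?_
    refine (ae_restrict_iff' (cube_meas c ρ)).mpr ?_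
    filter_upwards [hA1 c ρ hρ] with x hx hx'
    have h4 : b / A ≤ ω x := by rw [div_le_iff₀ hA0]; linarith [hx hx']
    have h5 : (b / A) ^ (1 - r) ≤ ω x ^ (1 - r) :=
      Real.rpow_le_rpow (by positivity) h4 (by linarith)
    have h6 : 0 ≤ |f x - a| ^ r := Real.rpow_nonneg (abs_nonneg _) _
    rw [mul_comm (|f x - a| ^ r)]
    exact mul_le_mul_of_nonneg_right h5 h6
  have hbA : 0 < (b / A) ^ (1 - r) := by positivity
  refine le_of_mul_le_mul_left ((h3.trans h1).trans (le_of_eq ?_)) hbA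
  have eW : W = b * ρ ^ n := by rw [hb]; field_simp
  rw [eW, Real.mul_rpow (by positivity) hbp.le, Real.mul_rpow (by positivity) hN.le,
    ← Real.rpow_mul hA0.le, div_mul_cancel₀ _ hr0.ne', Real.div_rpow hbp.le hA0.le]
  have hAr : 0 < A ^ (1 - r) := by positivity
  have ebb : b ^ (1 - r) * b ^ r = b := by
    rw [← Real.rpow_add hbp]; simp
  calc b * ρ ^ n * N ^ r = (b ^ (1 - r) * b ^ r) * ρ ^ n * N ^ r := by rw [ebb]
    _ = _ := by field_simp

/-- for `ω ∈ A₁` and `0 < r < 1`, `BMO(ω) = BMO^r(ω)` with equivalent norms: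
`C⁻¹ ‖f‖_{BMO(ω)} ≤ ‖f‖_{BMO^r(ω)} ≤ C ‖f‖_{BMO(ω)}`. -/
theorem stmt3 (n : ℕ) (r A : ℝ) (hr0 : 0 < r) (hr1 : r < 1) (hA : 1 ≤ A) :
    ∃ C : ℝ, 1 ≤ C ∧
      ∀ (ω f : Rn n → ℝ), IsA1 ω A → LocallyIntegrable f volume →
        ∀ N : ℝ, 0 ≤ N →
        -- `‖f‖_{BMO(ω)} ≤ C ‖f‖_{BMO^r(ω)}`
        (((∀ (c : Rn n) (ρ : ℝ), 0 < ρ →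
            ((wMeas ω (cube c ρ))⁻¹ *
              ∫ x in cube c ρ, |f x - avg f c ρ| ^ r * ω x ^ (1 - r)) ^ (1 / r) ≤ N) →
          ∀ (c : Rn n) (ρ : ℝ), 0 < ρ →
            (wMeas ω (cube c ρ))⁻¹ * ∫ x in cube c ρ, |f x - avg f c ρ| ≤ C * N) ∧
        -- `‖f‖_{BMO^r(ω)} ≤ C ‖f‖_{BMO(ω)}`
        ((∀ (c : Rn n) (ρ : ℝ), 0 < ρ →
            (wMeas ω (cube c ρ))⁻¹ * ∫ x in cube c ρ, |f x - avg f c ρ| ≤ N) →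
          ∀ (c : Rn n) (ρ : ℝ), 0 < ρ →
            ((wMeas ω (cube c ρ))⁻¹ *
              ∫ x in cube c ρ, |f x - avg f c ρ| ^ r * ω x ^ (1 - r)) ^ (1 / r) ≤ C * N)) := by
  set M : ℝ := 2 * A * (2 ^ (1 / r) * (1 + (2 ^ n * 2) ^ (1 / r))) * A ^ ((1 - r) / r) with hM
  have hA0 : 0 < A := by linarith
  have hMp : 0 < M := by positivity
  refine ⟨max 1 M, le_max_left _ _, ?_⟩
  intro ω f hA1 hf N hN
  have hpos := hA1.1
  have hω := hA1.2.1
  constructor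
  · intro h c ρ hρ
    have hW := wMeas_pos hω hpos c hρ
    have key : ∀ N', N < N' →
        (wMeas ω (cube c ρ))⁻¹ * ∫ x in cube c ρ, |f x - avg f c ρ| ≤ M * N' := by
      intro N' hN'
      have hN0 : 0 < N' := by linarith
      rw [inv_mul_le_iff₀ hW]
      refine int_le_of_dD hf _ _ c hρ fun k => ?_
      have hK : 0 < A ^ ((1 - r) / r) * N' := by positivity
      have := core hf hA1 hr0 hr1 hK (fun c ρ hρ =>
        unweight hf hA1 hr0 hr1 hN0 _ c hρ ((h c ρ hρ).trans hN'.le)) k c ρ hρ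
      refine this.trans (le_of_eq ?_)
      rw [hM]; ring
    have h1 : (wMeas ω (cube c ρ))⁻¹ * ∫ x in cube c ρ, |f x - avg f c ρ| ≤ M * N := by
      rw [← div_le_iff₀' hMp]
      refine le_of_forall_gt_imp_ge_of_dense fun N' hN' => ?_
      rw [div_le_iff₀' hMp]
      exact key N' hN'
    exact h1.trans (mul_le_mul_of_nonneg_right (le_max_right _ _) hN)
  · intro h c ρ hρ
    have h1 : ((wMeas ω (cube c ρ))⁻¹ *
        ∫ x in cube c ρ, |f x - avg f c ρ| ^ r * ω x ^ (1 - r)) ^ (1 / r) ≤ N := by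
      refine le_of_forall_gt_imp_ge_of_dense fun N' hN' => ?_
      exact dir2 hf hω hpos hr0 hr1 _ c hρ (by linarith) ((h c ρ hρ).trans hN'.le)
    have h2 : (1 : ℝ) ≤ max 1 M := le_max_left _ _
    nlinarith
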